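/- Let λ ∈ ℝ, let m be a positive integer and 0 ≤ p ≤ 1, and let Y be a binomial random variable with parameters m and p. Then for all real t with 1 + λt > 0 (all t ∈ ℝ when λ = 0), E[e_λ^Y(t)] = (p(e_λ(t)−1) + 1)^m. -/

import Mathlib

open MeasureTheory Filter Finset Topology

/-- The degenerate falling factorial `(x)_{n,λ} = x(x-λ)(x-2λ)⋯(x-(n-1)λ)`. -/
noncomputable def degFallFac (lam x : ℝ) : ℕ → ℝ
  | 0 => 1
  | n + 1 => degFallFac lam x n * (x - n * lam)

/-- The degenerate exponential `e_λ^y(t) = (1+λt)^{y/λ}` for `λ ≠ 0`, and `e^{yt}` for `λ = 0`. -/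
noncomputable def degExp (lam y t : ℝ) : ℝ :=
  if lam = 0 then Real.exp (y * t) else (1 + lam * t) ^ (y / lam)

/-- The generalized binomial coefficient `C(a,j) = a(a-1)⋯(a-j+1)/j!`. -/
noncomputable def genBinom (a : ℝ) (j : ℕ) : ℝ :=
  (∏ i ∈ Finset.range j, (a - (i : ℝ))) / (j.factorial : ℝ)

/-- The degenerate binomial coefficient `C_λ(x,k) = (x)_{k,λ}/k!`. -/
noncomputable def degBinom (lam x : ℝ) (k : ℕ) : ℝ :=
  degFallFac lam x k / (k.factorial : ℝ)

/-- A variable whose values at the naturals `j < n` carry total mass one has finitely supported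
expectations. -/
theorem integral_comp_eq_sum_of_sum_eq_one
    {Ω : Type*} [MeasurableSpace Ω] {μ : Measure Ω} [IsProbabilityMeasure μ]
    {Y : Ω → ℝ} (hY : Measurable Y) {n : ℕ} {w : ℕ → ℝ} (hw : ∀ j, 0 ≤ w j)
    (hlaw : ∀ j : ℕ, μ {ω | Y ω = (j : ℝ)} = ENNReal.ofReal (w j))
    (hsum : ∑ j ∈ range n, w j = 1) (f : ℝ → ℝ) :
    ∫ ω, f (Y ω) ∂μ = ∑ j ∈ range n, w j * f j := by
  have hmeas (j : ℕ) : MeasurableSet {ω | Y ω = (j : ℝ)} := hY (measurableSet_singleton _)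
  have hunion : μ (⋃ j ∈ range n, {ω | Y ω = (j : ℝ)}) = 1 := by
    rw [measure_biUnion_finset _ fun j _ => hmeas j]
    · simp only [hlaw]
      rw [← ENNReal.ofReal_sum_of_nonneg fun j _ => hw j, hsum, ENNReal.ofReal_one]
    · intro i _ j _ hij
      refine Set.disjoint_left.2 fun ω (hi : Y ω = i) (hj : Y ω = j) => hij ?_
      exact_mod_cast hi.symm.trans hj
  have hae : ∀ᵐ ω ∂μ, ω ∈ ⋃ j ∈ range n, {ω | Y ω = (j : ℝ)} :=
    (prob_compl_eq_zero_iff (Finset.measurableSet_biUnion _ fun j _ => hmeas j)).2 hunion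
  have hind : (fun ω => f (Y ω)) =ᵐ[μ]
      fun ω => ∑ j ∈ range n, {ω | Y ω = (j : ℝ)}.indicator (fun _ => f j) ω := by
    filter_upwards [hae] with ω hω
    obtain ⟨k, hk, hYk⟩ : ∃ k ∈ range n, Y ω = (k : ℝ) := by simpa using hω
    rw [Finset.sum_eq_single_of_mem k hk]
    · simp [Set.indicator, hYk]
    · intro j _ hjk
      simp [Set.indicator, hYk, hjk.symm]
  rw [integral_congr_ae hind,
    integral_finsetSum _ fun j _ => (integrable_const _).indicator (hmeas j)]
  refine Finset.sum_congr rfl fun j _ => ?_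
  rw [integral_indicator_const _ (hmeas j), measureReal_def, hlaw,
    ENNReal.toReal_ofReal (hw j), smul_eq_mul]

theorem degExp_natCast {lam t : ℝ} (h : 0 < 1 + lam * t) (j : ℕ) :
    degExp lam j t = degExp lam 1 t ^ j := by
  unfold degExp
  split_ifs
  · rw [← Real.exp_nat_mul, one_mul]
  · rw [← Real.rpow_mul_natCast h.le, one_div_mul_eq_div]

/-- **Equation (39).** For `Y` binomial with parameters `m, p`:
`E[e_λ^Y(t)] = (p(e_λ(t)-1)+1)^m` for all `t` with `1+λt > 0`
(all `t ∈ ℝ` when `λ = 0`). -/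
theorem binomial_expectation_degExp_eq_pow
    {Ω : Type*} [MeasurableSpace Ω] (μ : Measure Ω) [IsProbabilityMeasure μ]
    (Y : Ω → ℝ) (hYm : Measurable Y)
    (m : ℕ) (hm : 0 < m) (p : ℝ) (hp0 : 0 ≤ p) (hp1 : p ≤ 1)
    -- `Y` is binomial with parameters `m` and `p`:
    (hlaw : ∀ j : ℕ, μ {ω | Y ω = (j : ℝ)}
      = ENNReal.ofReal ((m.choose j : ℝ) * p ^ j * (1 - p) ^ (m - j)))
    (lam : ℝ) :
    ∀ t : ℝ, 1 + lam * t > 0 →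
      (∫ ω, degExp lam (Y ω) t ∂μ) = (p * (degExp lam 1 t - 1) + 1) ^ m := by
  intro t ht
  rw [integral_comp_eq_sum_of_sum_eq_one (n := m + 1) hYm (fun j => by
    have := sub_nonneg.2 hp1
    positivity) hlaw ?_ fun y => degExp lam y t]
  · rw [show p * (degExp lam 1 t - 1) + 1 = p * degExp lam 1 t + (1 - p) by ring, add_pow]
    refine Finset.sum_congr rfl fun j _ => ?_
    rw [degExp_natCast ht, mul_pow]
    ring
  · have h := add_pow p (1 - p) m
    rw [add_sub_cancel, one_pow] at h
    exact (Finset.sum_congr rfl fun j _ => by ring).trans h.symm
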